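/- Let φ:(R,m)→(S,n) be a flat local homomorphism of Noetherian local rings of prime characteristic p such that the closed fiber S/mS is Gorenstein. Assume that R is weakly F-regular and Cohen–Macaulay, that there is an element c ∈ R° whose image lies in S° and which is a test element for both R and S, and that S/mS is F-injective. Then S is weakly F-regular. -/

import Mathlib

open IsLocalRing

/-- The Frobenius power `I^[q]` of an ideal: the ideal generated by the `q`-th powers
of the elements of `I`. -/
def Ideal.frobPow {R : Type*} [CommRing R] (I : Ideal R) (q : ℕ) : Ideal R :=
  Ideal.span ((fun x : R => x ^ q) '' (I : Set R))

/-- `R°`: the complement in `R` of the union of the minimal primes of `R`. -/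
def circComplement (R : Type*) [CommRing R] : Set R :=
  {c : R | ∀ P ∈ minimalPrimes R, c ∉ P}

/-- `x ∈ I*`: tight closure membership (`p` is the characteristic). -/
def MemTightClosure {R : Type*} [CommRing R] (p : ℕ) (I : Ideal R) (x : R) : Prop :=
  ∃ c ∈ circComplement R, ∃ N : ℕ, ∀ e : ℕ, N ≤ e → c * x ^ p ^ e ∈ I.frobPow (p ^ e)

/-- An ideal is tightly closed if `I* = I`. -/
def Ideal.IsTightlyClosed {R : Type*} [CommRing R] (p : ℕ) (I : Ideal R) : Prop :=
  ∀ x : R, MemTightClosure p I x → x ∈ I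

/-- An ideal is Frobenius closed if `x^q ∈ I^[q]` for some `q` implies `x ∈ I`. -/
def Ideal.IsFrobeniusClosed {R : Type*} [CommRing R] (p : ℕ) (I : Ideal R) : Prop :=
  ∀ x : R, (∃ e : ℕ, x ^ p ^ e ∈ I.frobPow (p ^ e)) → x ∈ I

/-- A ring is weakly F-regular if every ideal is tightly closed. -/
def IsWeaklyFRegular (R : Type*) [CommRing R] (p : ℕ) : Prop :=
  ∀ I : Ideal R, I.IsTightlyClosed p

/-- A test element: an element of `R°` that works in every tight closure test. -/
def IsTestElement {R : Type*} [CommRing R] (p : ℕ) (c : R) : Prop :=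
  c ∈ circComplement R ∧
    ∀ (I : Ideal R) (x : R), MemTightClosure p I x → ∀ e : ℕ, c * x ^ p ^ e ∈ I.frobPow (p ^ e)

/-- A (full) system of parameters of a local ring: `dim R` elements of the maximal
ideal generating an ideal whose radical is the maximal ideal. -/
def IsSystemOfParameters (R : Type*) [CommRing R] [IsLocalRing R] {n : ℕ} (x : Fin n → R) : Prop :=
  ringKrullDim R = n ∧ (∀ i, x i ∈ maximalIdeal R) ∧
    maximalIdeal R ≤ (Ideal.span (Set.range x)).radical

/-- A parameter ideal: an ideal generated by part of a system of parameters. -/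
def Ideal.IsParameterIdeal {R : Type*} [CommRing R] [IsLocalRing R] (I : Ideal R) : Prop :=
  ∃ (n k : ℕ) (h : k ≤ n) (x : Fin n → R), IsSystemOfParameters R x ∧
    I = Ideal.span (Set.range fun i : Fin k => x (Fin.castLE h i))

/-- A local ring is F-rational if every parameter ideal is tightly closed. -/
def IsFRational (R : Type*) [CommRing R] [IsLocalRing R] (p : ℕ) : Prop :=
  ∀ I : Ideal R, I.IsParameterIdeal → I.IsTightlyClosed p

/-- A local ring is F-injective if every parameter ideal is Frobenius closed. -/
def IsFInjective (R : Type*) [CommRing R] [IsLocalRing R] (p : ℕ) : Prop :=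
  ∀ I : Ideal R, I.IsParameterIdeal → I.IsFrobeniusClosed p

/-- A local ring is Cohen-Macaulay if some system of parameters is a regular sequence. -/
def IsCohenMacaulayLocalRing (R : Type*) [CommRing R] [IsLocalRing R] : Prop :=
  ∃ (n : ℕ) (x : Fin n → R), IsSystemOfParameters R x ∧
    RingTheory.Sequence.IsRegular R (List.ofFn x)

/-- An irreducible ideal: a proper ideal that is not the intersection of two
strictly larger ideals. -/
def Ideal.IsIrreducible {R : Type*} [CommRing R] (I : Ideal R) : Prop :=
  I ≠ ⊤ ∧ ∀ A B : Ideal R, I = A ⊓ B → I = A ∨ I = B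

/-- A local ring is Gorenstein if it is Cohen-Macaulay and some system of parameters
generates an irreducible ideal. -/
def IsGorensteinLocalRing (R : Type*) [CommRing R] [IsLocalRing R] : Prop :=
  ∃ (n : ℕ) (x : Fin n → R), IsSystemOfParameters R x ∧
    RingTheory.Sequence.IsRegular R (List.ofFn x) ∧
    (Ideal.span (Set.range x)).IsIrreducible

namespace Ideal

section Monolith

variable {B : Type*} [CommRing B]

lemma mem_sup_span_singleton_iff_exists_sub_mem {Q : Ideal B} {a x : B} :
    x ∈ Q ⊔ span {a} ↔ ∃ s, x - a * s ∈ Q := by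
  constructor
  · intro h
    obtain ⟨q, hq, y, hy, rfl⟩ := Submodule.mem_sup.1 h
    obtain ⟨s, rfl⟩ := mem_span_singleton'.1 hy
    exact ⟨s, by simpa [mul_comm] using hq⟩
  · rintro ⟨s, hs⟩
    have : x = (x - a * s) + a * s := by ring
    rw [this]
    exact add_mem (mem_sup_left hs) (mem_sup_right (mul_mem_right _ _ (mem_span_singleton_self a)))

/-- `b` generates the smallest nonzero ideal of `B ⧸ Q`. -/
def IsMonolith (Q : Ideal B) (b : B) : Prop :=
  b ∉ Q ∧ ∀ w ∉ Q, b ∈ Q ⊔ span {w}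

/-- An ideal maximal among those not containing `x` has `x` as a monolith. -/
lemma exists_le_isMonolith [IsNoetherianRing B] {Q : Ideal B} {x : B} (hx : x ∉ Q) :
    ∃ J, Q ≤ J ∧ IsMonolith J x := by
  obtain ⟨J, ⟨hQJ, hxJ⟩, hmax⟩ :=
    set_has_maximal_iff_noetherian.2 (inferInstanceAs (IsNoetherian B B))
      {J : Ideal B | Q ≤ J ∧ x ∉ J} ⟨Q, le_rfl, hx⟩
  refine ⟨J, hQJ, hxJ, fun w hw => ?_⟩
  by_contra h
  refine hmax (J ⊔ span {w}) ⟨hQJ.trans le_sup_left, h⟩ ?_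
  refine lt_of_le_of_ne le_sup_left fun he => hw ?_
  rw [he]
  exact mem_sup_right (mem_span_singleton_self w)

lemma IsMonolith.mul_mem [IsLocalRing B] {Q : Ideal B} {b r : B} (h : IsMonolith Q b)
    (hr : r ∈ maximalIdeal B) : r * b ∈ Q := by
  by_contra hc
  obtain ⟨s, hs⟩ := mem_sup_span_singleton_iff_exists_sub_mem.1 (h.2 _ hc)
  have hu : IsUnit (1 - r * s) :=
    isUnit_one_sub_self_of_mem_nonunits _ (mul_mem_right s _ hr)
  refine h.1 ((Q.unit_mul_mem_iff_mem hu).1 ?_)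
  convert hs using 1
  ring

lemma IsMonolith.pow_le [IsNoetherianRing B] [IsLocalRing B] {Q : Ideal B} {b : B}
    (h : IsMonolith Q b) : ∃ n, maximalIdeal B ^ n ≤ Q := by
  by_contra! hc
  have hb : ∀ n, b ∈ Q ⊔ maximalIdeal B ^ n := by
    intro n
    obtain ⟨w, hw, hwQ⟩ := SetLike.not_le_iff_exists.1 (hc n)
    exact sup_le_sup_left ((span_singleton_le_iff_mem _).2 hw) Q (h.2 w hwQ)
  have key := iInf_pow_smul_eq_bot_of_isLocalRing (M := B ⧸ Q) (maximalIdeal B)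
    (maximalIdeal.isMaximal B).ne_top
  have : Ideal.Quotient.mk Q b ∈ (⨅ i : ℕ, maximalIdeal B ^ i • ⊤ : Submodule B (B ⧸ Q)) := by
    rw [Submodule.mem_iInf]
    intro n
    obtain ⟨q, hq, y, hy, hqy⟩ := Submodule.mem_sup.1 (hb n)
    have : Ideal.Quotient.mk Q b = y • (1 : B ⧸ Q) := by
      rw [← hqy, map_add, Ideal.Quotient.eq_zero_iff_mem.2 hq, zero_add, Algebra.smul_def, mul_one]
      rfl
    rw [this]
    exact Submodule.smul_mem_smul hy trivial
  rw [key, Submodule.mem_bot, Ideal.Quotient.eq_zero_iff_mem] at this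
  exact h.1 this

/-- Every element outside `Q` has a multiple in the socle of `B ⧸ Q` if `Q` is primary to the
maximal ideal. -/
lemma exists_mul_notMem_of_pow_le [IsLocalRing B] {Q : Ideal B} {n : ℕ}
    (hn : maximalIdeal B ^ n ≤ Q) {w : B} (hw : w ∉ Q) :
    ∃ r, r * w ∉ Q ∧ ∀ s ∈ maximalIdeal B, s * (r * w) ∈ Q := by
  classical
  have hex : ∃ k, ∀ r ∈ maximalIdeal B ^ k, r * w ∈ Q :=
    ⟨n, fun r hr => Q.mul_mem_right _ (hn hr)⟩
  have hmin := Nat.find_spec hex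
  obtain ⟨k, hk⟩ : ∃ k, Nat.find hex = k + 1 := by
    refine Nat.exists_eq_succ_of_ne_zero fun h0 => hw ?_
    rw [h0] at hmin
    simpa using hmin 1 (by simp)
  have hlt := Nat.find_min hex (m := k) (by omega)
  push Not at hlt
  obtain ⟨r, hr, hrw⟩ := hlt
  refine ⟨r, hrw, fun s hs => ?_⟩
  rw [hk] at hmin
  rw [← mul_assoc]
  refine hmin _ ?_
  rw [pow_succ']
  exact mul_mem_mul hs hr

end Monolith

section Irreducible

variable {B : Type*} [CommRing B] [IsLocalRing B]

lemma IsIrreducible.exists_isMonolith {Q : Ideal B} (hQ : Q.IsIrreducible) {n : ℕ}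
    (hn : maximalIdeal B ^ n ≤ Q) : ∃ b, IsMonolith Q b := by
  obtain ⟨r, hb, hsoc⟩ := exists_mul_notMem_of_pow_le hn ((ne_top_iff_one Q).1 hQ.1)
  rw [mul_one] at hb hsoc
  refine ⟨r, hb, fun w hw => ?_⟩
  obtain ⟨r', hw', hsoc'⟩ := exists_mul_notMem_of_pow_le hn hw
  by_contra hc
  have hinf : Q = (Q ⊔ span {r}) ⊓ (Q ⊔ span {r' * w}) := by
    refine le_antisymm (le_inf le_sup_left le_sup_left) ?_
    rintro z ⟨hz1, hz2⟩
    obtain ⟨s, hs⟩ := mem_sup_span_singleton_iff_exists_sub_mem.1 hz1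
    by_cases hu : IsUnit s
    · refine absurd ?_ hc
      have hle : Q ⊔ span {r' * w} ≤ Q ⊔ span {w} :=
        sup_le_sup_left (span_singleton_le_span_singleton.2 (dvd_mul_left _ _)) Q
      refine hle ?_
      rw [← unit_mul_mem_iff_mem _ hu]
      have := sub_mem hz2 (mem_sup_left (T := span {r' * w}) hs)
      convert this using 1
      ring
    · have := add_mem hs (hsoc s hu)
      convert this using 1
      ring
  rcases hQ.2 _ _ hinf with h | h
  · apply hb
    rw [h]
    exact mem_sup_right (mem_span_singleton_self r)
  · apply hw'
    rw [h]
    exact mem_sup_right (mem_span_singleton_self _)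

end Irreducible

section CommonRefinement

variable {B : Type*} [CommRing B] [IsLocalRing B]

/-- In the presence of a regular sequence of length two in the maximal ideal, two ideals with
monoliths contain a third one. -/
lemma IsMonolith.exists_le_inf [IsNoetherianRing B] {I₁ I₂ : Ideal B} {u₁ u₂ : B}
    (h₁ : IsMonolith I₁ u₁) (h₂ : IsMonolith I₂ u₂) {x y : B}
    (hxm : x ∈ maximalIdeal B) (hym : y ∈ maximalIdeal B)
    (hx : ∀ s, x * s = 0 → s = 0) (hxy : ∀ s, y * s ∈ span {x} → s ∈ span {x}) :
    ∃ I u, IsMonolith I u ∧ I ≤ I₁ ⊓ I₂ := by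
  have hx' : ∀ n s, x ^ n * s = 0 → s = 0 := by
    intro n
    induction n with
    | zero => simp
    | succ n ih =>
      intro s hs
      exact hx s (ih _ (by rw [← hs]; ring))
  have hyx : ∀ n s t, y * s = x ^ n * t → ∃ s', s = x ^ n * s' := by
    intro n
    induction n with
    | zero => exact fun s t _ => ⟨s, by simp⟩
    | succ n ih =>
      intro s t hst
      obtain ⟨s₁, hs₁⟩ := mem_span_singleton'.1
        (hxy s (mem_span_singleton'.2 ⟨x ^ n * t, by rw [hst]; ring⟩))
      obtain ⟨s', hs'⟩ := ih s₁ t (by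
        rw [← sub_eq_zero]
        apply hx
        linear_combination hst + y * hs₁)
      exact ⟨s', by rw [← hs₁, hs']; ring⟩
  have hyx' : ∀ m n s t, y ^ m * s = x ^ n * t → ∃ s', s = x ^ n * s' := by
    intro m n
    induction m with
    | zero => exact fun s t h => ⟨t, by simpa using h⟩
    | succ m ih =>
      intro s t hst
      obtain ⟨s₁, hs₁⟩ := hyx n (y ^ m * s) t (by rw [← hst]; ring)
      exact ih s s₁ hs₁
  obtain ⟨a, ha⟩ := h₂.pow_le
  obtain ⟨b, hb⟩ := h₁.pow_le
  replace ha : x ^ a ∈ I₂ := ha (pow_mem_pow hxm a)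
  replace hb : y ^ b ∈ I₁ := hb (pow_mem_pow hym b)
  let K : Ideal B := (span {x ^ a} * I₁ ⊔ span {y ^ b} * I₂) ⊔ span {x ^ a * u₁ - y ^ b * u₂}
  have hK : x ^ a * u₁ ∉ K := by
    intro h
    obtain ⟨t, ht⟩ := mem_sup_span_singleton_iff_exists_sub_mem.1 h
    obtain ⟨_, hm₁, _, hm₂, he⟩ := Submodule.mem_sup.1 ht
    obtain ⟨i₁, hi₁, rfl⟩ := mem_span_singleton_mul.1 hm₁
    obtain ⟨i₂, hi₂, rfl⟩ := mem_span_singleton_mul.1 hm₂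
    have h1 : y ^ b * (i₂ - t * u₂) = x ^ a * (u₁ - i₁ - t * u₁) := by
      linear_combination he
    obtain ⟨s', hs'⟩ := hyx' b a _ _ h1
    have htu : t * u₂ ∈ I₂ := by
      have : t * u₂ = i₂ - x ^ a * s' := by rw [← hs']; ring
      rw [this]
      exact sub_mem hi₂ (I₂.mul_mem_right _ ha)
    have htm : t ∈ maximalIdeal B := fun hu => h₂.1 ((I₂.unit_mul_mem_iff_mem hu).1 htu)
    have h2 : u₁ - i₁ - t * u₁ = y ^ b * s' := by
      rw [← sub_eq_zero]
      apply hx' a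
      rw [mul_sub, ← h1, hs']
      ring
    refine h₁.1 ((I₁.unit_mul_mem_iff_mem
      (isUnit_one_sub_self_of_mem_nonunits _ htm)).1 ?_)
    have : (1 - t) * u₁ = i₁ + y ^ b * s' := by rw [← h2]; ring
    rw [this]
    exact add_mem hi₁ (I₁.mul_mem_right _ hb)
  obtain ⟨I, hKI, hI⟩ := exists_le_isMonolith hK
  refine ⟨I, _, hI, le_inf (fun r hr => ?_) (fun r hr => ?_)⟩
  · by_contra hr₁
    obtain ⟨s, hs⟩ := mem_sup_span_singleton_iff_exists_sub_mem.1 (h₁.2 r hr₁)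
    have h3 : x ^ a * (u₁ - r * s) ∈ I :=
      hKI (mem_sup_left (mem_sup_left (mul_mem_mul (mem_span_singleton_self _) hs)))
    refine hI.1 ?_
    have : x ^ a * u₁ = x ^ a * (u₁ - r * s) + r * (x ^ a * s) := by ring
    rw [this]
    exact add_mem h3 (I.mul_mem_right _ hr)
  · by_contra hr₂
    obtain ⟨s, hs⟩ := mem_sup_span_singleton_iff_exists_sub_mem.1 (h₂.2 r hr₂)
    have h3 : y ^ b * (u₂ - r * s) ∈ I :=
      hKI (mem_sup_left (mem_sup_right (mul_mem_mul (mem_span_singleton_self _) hs)))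
    have h4 : x ^ a * u₁ - y ^ b * u₂ ∈ I := hKI (mem_sup_right (mem_span_singleton_self _))
    refine hI.1 ?_
    have : x ^ a * u₁ = (x ^ a * u₁ - y ^ b * u₂) + y ^ b * (u₂ - r * s) + r * (y ^ b * s) := by
      ring
    rw [this]
    exact add_mem (add_mem h4 h3) (I.mul_mem_right _ hr)

lemma isMonolith_maximalIdeal : IsMonolith (maximalIdeal B) 1 :=
  ⟨fun h => (mem_maximalIdeal _).1 h isUnit_one, fun w hw => by
    rw [mem_maximalIdeal, mem_nonunits_iff, not_not] at hw
    rw [span_singleton_eq_top.2 hw, sup_top_eq]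
    trivial⟩

/-- A Noetherian local ring of depth at least two is approximately Gorenstein. -/
lemma exists_isMonolith_le_pow [IsNoetherianRing B] {x y : B}
    (hxm : x ∈ maximalIdeal B) (hym : y ∈ maximalIdeal B)
    (hx : ∀ s, x * s = 0 → s = 0) (hxy : ∀ s, y * s ∈ span {x} → s ∈ span {x}) (n : ℕ) :
    ∃ I u, IsMonolith I u ∧ I ≤ maximalIdeal B ^ n := by
  obtain ⟨s, hs, hirr⟩ := exists_infIrred_decomposition (maximalIdeal B ^ n)
  rw [← hs]
  replace hs : ∀ J ∈ s, maximalIdeal B ^ n ≤ J := fun J hJ => hs ▸ Finset.inf_le hJ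
  classical
  induction s using Finset.induction_on with
  | empty => exact ⟨_, _, isMonolith_maximalIdeal, by simp⟩
  | insert J s hJs ih =>
    obtain ⟨I, u, hI, hle⟩ := ih (fun J hJ => hirr (Finset.mem_insert_of_mem hJ))
      (fun J hJ => hs J (Finset.mem_insert_of_mem hJ))
    have hJ := hirr (Finset.mem_insert_self J s)
    obtain ⟨b, hb⟩ := IsIrreducible.exists_isMonolith (Q := J)
      ⟨fun h => hJ.1 (h ▸ isMax_top), fun A C h => (hJ.2 h.symm).imp Eq.symm Eq.symm⟩
      (hs J (Finset.mem_insert_self J s))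
    obtain ⟨I', u', hI', hle'⟩ := hb.exists_le_inf hI hxm hym hx hxy
    refine ⟨I', u', hI', hle'.trans ?_⟩
    rw [Finset.inf_insert]
    exact inf_le_inf le_rfl hle

end CommonRefinement

section DoubleAnnihilator

variable {B : Type*} [CommRing B]

/-- In a local ring with a smallest nonzero ideal, annihilators turn a cover into a weak cover. -/
lemma IsMonolith.annihilator_wcovBy [IsLocalRing B] {u : B} (hu : IsMonolith ⊥ u)
    {J J' : Ideal B} (h : J ⋖ J') : J'.annihilator ⩿ J.annihilator := by
  refine ⟨Submodule.annihilator_mono h.le, fun C hC hC' => ?_⟩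
  obtain ⟨v, hvJ', hvJ⟩ := SetLike.exists_of_lt h.lt
  have hJ' : J ⊔ span {v} = J' := by
    rcases h.eq_or_eq le_sup_left (sup_le h.le ((span_singleton_le_iff_mem _).2 hvJ')) with h' | h'
    · refine absurd ?_ hvJ
      rw [← h']
      exact mem_sup_right (mem_span_singleton_self v)
    · exact h'
  have hann : ∀ r, r ∈ J'.annihilator ↔ r ∈ J.annihilator ∧ r * v = 0 := by
    intro r
    constructor
    · exact fun hr => ⟨Submodule.annihilator_mono h.le hr,
        Submodule.mem_annihilator.1 hr v hvJ'⟩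
    · rintro ⟨hr, hrv⟩
      rw [Submodule.mem_annihilator]
      intro n hn
      rw [← hJ'] at hn
      obtain ⟨s, hs⟩ := mem_sup_span_singleton_iff_exists_sub_mem.1 hn
      have h1 : r * (n - v * s) = 0 := Submodule.mem_annihilator.1 hr _ hs
      rw [smul_eq_mul]
      linear_combination h1 + s * hrv
  have hmv : ∀ s ∈ maximalIdeal B, s * v ∈ J := by
    intro s hs
    by_contra hsv
    have : J ⊔ span {s * v} = J' := by
      rcases h.eq_or_eq (c := J ⊔ span {s * v}) le_sup_left (sup_le h.le
        ((span_singleton_le_iff_mem _).2 (J'.mul_mem_left _ hvJ'))) with h' | h'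
      · refine absurd ?_ hsv
        rw [← h']
        exact mem_sup_right (mem_span_singleton_self _)
      · exact h'
    rw [← this] at hvJ'
    obtain ⟨t, ht⟩ := mem_sup_span_singleton_iff_exists_sub_mem.1 hvJ'
    refine hvJ ((J.unit_mul_mem_iff_mem
      (isUnit_one_sub_self_of_mem_nonunits _ ((maximalIdeal B).mul_mem_right t hs))).1 ?_)
    convert ht using 1
    ring
  have hsoc : ∀ w, (∀ s ∈ maximalIdeal B, s * w = 0) → w ≠ 0 → ∃ t, IsUnit t ∧ u = w * t := by
    intro w hw hw0
    obtain ⟨t, ht⟩ := mem_sup_span_singleton_iff_exists_sub_mem.1 (hu.2 w hw0)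
    rw [mem_bot, sub_eq_zero] at ht
    refine ⟨t, ?_, ht⟩
    by_contra htu
    refine hu.1 ?_
    rw [mem_bot, ht, mul_comm]
    exact hw t htu
  have hkill : ∀ r ∈ J.annihilator, ∀ s ∈ maximalIdeal B, s * (r * v) = 0 := by
    intro r hr s hs
    rw [mul_left_comm]
    exact Submodule.mem_annihilator.1 hr _ (hmv s hs)
  obtain ⟨r₀, hr₀C, hr₀⟩ := SetLike.exists_of_lt hC
  have hr₀J := hC'.le hr₀C
  have hr₀v : r₀ * v ≠ 0 := fun h0 => hr₀ ((hann _).2 ⟨hr₀J, h0⟩)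
  refine hC'.not_ge fun r hr => ?_
  by_cases hrv : r * v = 0
  · exact hC.le ((hann r).2 ⟨hr, hrv⟩)
  · obtain ⟨t₀, -, h₀⟩ := hsoc _ (hkill r₀ hr₀J) hr₀v
    obtain ⟨t, ht, h₁⟩ := hsoc _ (hkill r hr) hrv
    have : r * t - r₀ * t₀ ∈ J'.annihilator := by
      refine (hann _).2 ⟨sub_mem (mul_mem_right _ _ hr) (mul_mem_right _ _ hr₀J), ?_⟩
      linear_combination h₀ - h₁
    have h2 := add_mem (hC.le this) (C.mul_mem_right t₀ hr₀C)
    rw [sub_add_cancel] at h2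
    exact (C.mul_unit_mem_iff_mem ht).1 h2

lemma length_eq_length_add_one_of_covBy {J J' : Ideal B} (h : J ⋖ J') :
    Module.length B J' = Module.length B J + 1 := by
  have := (covBy_iff_quot_is_simple h.le).1 h
  rw [Module.length_eq_add_of_exact (J.submoduleOf J').subtype (J.submoduleOf J').mkQ
    (Submodule.subtype_injective _) (Submodule.mkQ_surjective _)
    (LinearMap.exact_subtype_mkQ _), (Submodule.submoduleOfEquivOfLe h.le).length_eq]
  congr 1
  exact Module.length_eq_one_iff.2 this

lemma length_le_length_add_one_of_wcovBy {J J' : Ideal B} (h : J ⩿ J') :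
    Module.length B J' ≤ Module.length B J + 1 := by
  rcases h.covBy_or_eq with h | h
  · exact (length_eq_length_add_one_of_covBy h).le
  · rw [h]
    exact le_self_add

/-- Annihilators separate ideals in an Artinian local ring with a smallest nonzero ideal. -/
lemma IsMonolith.exists_mem_annihilator [IsLocalRing B] [IsArtinianRing B] {u : B}
    (hu : IsMonolith ⊥ u) {J : Ideal B} {v : B} (hv : v ∉ J) :
    ∃ r ∈ J.annihilator, r * v ≠ 0 := by
  have hmono : ∀ J J' : Ideal B, J ≤ J' →
      Module.length B J + Module.length B J.annihilator ≤
        Module.length B J' + Module.length B J'.annihilator := by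
    intro J J' hle
    induction J using WellFoundedGT.induction with
    | ind J ih =>
      rcases hle.eq_or_lt with rfl | hlt
      · exact le_rfl
      · obtain ⟨J₁, hcov, hJ₁⟩ := exists_covBy_le_of_lt hlt
        refine le_trans ?_ (ih J₁ hcov.lt hJ₁)
        rw [length_eq_length_add_one_of_covBy hcov, add_assoc, add_comm 1]
        gcongr
        exact length_le_length_add_one_of_wcovBy (hu.annihilator_wcovBy hcov)
  have hconst : ∀ J : Ideal B,
      Module.length B J + Module.length B J.annihilator = Module.length B B := by
    intro J
    apply le_antisymm
    · refine (hmono J ⊤ le_top).trans ?_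
      have : (⊤ : Ideal B).annihilator = ⊥ :=
        eq_bot_iff.2 fun r hr => by simpa using Submodule.mem_annihilator.1 hr 1 trivial
      rw [this, Module.length_top, Module.length_bot, add_zero]
    · refine le_trans ?_ (hmono ⊥ J bot_le)
      have : (⊥ : Ideal B).annihilator = ⊤ := Submodule.annihilator_bot
      rw [this, Module.length_top, Module.length_bot, zero_add]
  by_contra! h
  have hlt : J < J ⊔ span {v} := by
    refine lt_of_le_of_ne le_sup_left fun he => hv ?_
    rw [he]
    exact mem_sup_right (mem_span_singleton_self v)
  have hann : (J ⊔ span {v}).annihilator = J.annihilator := by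
    refine le_antisymm (Submodule.annihilator_mono le_sup_left) fun r hr => ?_
    rw [Submodule.mem_annihilator]
    intro n hn
    obtain ⟨s, hs⟩ := mem_sup_span_singleton_iff_exists_sub_mem.1 hn
    have h1 : r * (n - v * s) = 0 := Submodule.mem_annihilator.1 hr _ hs
    rw [smul_eq_mul]
    linear_combination h1 + s * h r hr
  have h1 := hconst J
  rw [← hconst (J ⊔ span {v}), hann] at h1
  have h2 : Module.length B J < Module.length B (J ⊔ span {v} : Ideal B) := by
    rw [Module.length_submodule, Module.length_submodule]
    exact Submodule.height_strictMono hlt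
  exact h2.ne (WithTop.add_right_cancel Module.length_ne_top h1)

lemma IsMonolith.exists_mul_mem [IsNoetherianRing B] [IsLocalRing B] {Q J : Ideal B} {b v : B}
    (hb : IsMonolith Q b) (hQJ : Q ≤ J) (hv : v ∉ J) :
    ∃ r, (∀ j ∈ J, r * j ∈ Q) ∧ r * v ∉ Q := by
  have hQ : Q ≠ ⊤ := fun h => hb.1 (h ▸ trivial)
  have : Nontrivial (B ⧸ Q) := Quotient.nontrivial_iff.2 hQ
  have : IsLocalRing (B ⧸ Q) := .of_surjective' _ Quotient.mk_surjective
  have : IsArtinianRing (B ⧸ Q) := by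
    rw [isArtinianRing_iff_isNilpotent_maximalIdeal]
    obtain ⟨n, hn⟩ := hb.pow_le
    refine ⟨n, ?_⟩
    have hmap : (maximalIdeal B).map (Quotient.mk Q) = maximalIdeal (B ⧸ Q) :=
      (map_maximalIdeal_of_surjective _ Quotient.mk_surjective)
    rw [← hmap, ← Ideal.map_pow, zero_eq_bot, map_eq_bot_iff_le_ker, mk_ker]
    exact hn
  have hu : IsMonolith (⊥ : Ideal (B ⧸ Q)) (Quotient.mk Q b) := by
    refine ⟨by rw [mem_bot, Quotient.eq_zero_iff_mem]; exact hb.1, fun w hw => ?_⟩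
    obtain ⟨w, rfl⟩ := Quotient.mk_surjective w
    rw [mem_bot, Quotient.eq_zero_iff_mem] at hw
    obtain ⟨s, hs⟩ := mem_sup_span_singleton_iff_exists_sub_mem.1 (hb.2 w hw)
    refine mem_sup_span_singleton_iff_exists_sub_mem.2 ⟨Quotient.mk Q s, ?_⟩
    rwa [← map_mul, ← map_sub, mem_bot, Quotient.eq_zero_iff_mem]
  have hv' : Quotient.mk Q v ∉ J.map (Quotient.mk Q) := by
    rwa [mem_quotient_iff_mem hQJ]
  obtain ⟨r, hr, hrv⟩ := hu.exists_mem_annihilator hv'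
  obtain ⟨r, rfl⟩ := Quotient.mk_surjective r
  refine ⟨r, fun j hj => ?_, ?_⟩
  · have := Submodule.mem_annihilator.1 hr _ (mem_map_of_mem _ hj)
    rwa [smul_eq_mul, ← map_mul, Quotient.eq_zero_iff_mem] at this
  · rwa [← map_mul, ne_eq, Quotient.eq_zero_iff_mem] at hrv

end DoubleAnnihilator

section RegularMod

variable {B C : Type*} [CommRing B] [CommRing C]

/-- The list is a weakly regular sequence on `B ⧸ Q`. -/
def IsRegularMod (Q : Ideal B) : List B → Prop
  | [] => True
  | a :: l => (∀ s, a * s ∈ Q → s ∈ Q) ∧ IsRegularMod (Q ⊔ span {a}) l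

lemma regularMod_pow {Q : Ideal B} {a : B} (ha : ∀ s, a * s ∈ Q → s ∈ Q) (n : ℕ) :
    ∀ s, a ^ n * s ∈ Q → s ∈ Q := by
  induction n with
  | zero => simp
  | succ n ih =>
    intro s hs
    refine ih s (ha _ ?_)
    rwa [← mul_assoc, ← pow_succ']

lemma regularMod_sup_swap {Q : Ideal B} {a b : B} (ha : ∀ s, a * s ∈ Q → s ∈ Q)
    (hb : ∀ s, b * s ∈ Q ⊔ span {a} → s ∈ Q ⊔ span {a}) :
    ∀ s, a * s ∈ Q ⊔ span {b} → s ∈ Q ⊔ span {b} := by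
  intro s hs
  obtain ⟨r, hr⟩ := mem_sup_span_singleton_iff_exists_sub_mem.1 hs
  have h1 : b * r ∈ Q ⊔ span {a} := by
    refine mem_sup_span_singleton_iff_exists_sub_mem.2 ⟨s, ?_⟩
    convert neg_mem hr using 1
    ring
  obtain ⟨r₁, hr₁⟩ := mem_sup_span_singleton_iff_exists_sub_mem.1 (hb r h1)
  refine mem_sup_span_singleton_iff_exists_sub_mem.2 ⟨r₁, ha _ ?_⟩
  convert add_mem hr (Q.mul_mem_left b hr₁) using 1
  ring

lemma regularMod_sup_pow {Q : Ideal B} {a b : B} (ha : ∀ s, a * s ∈ Q → s ∈ Q)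
    (hb : ∀ s, b * s ∈ Q ⊔ span {a} → s ∈ Q ⊔ span {a}) (n : ℕ) :
    ∀ s, b * s ∈ Q ⊔ span {a ^ n} → s ∈ Q ⊔ span {a ^ n} := by
  induction n with
  | zero =>
    intro s _
    rw [pow_zero, span_singleton_one, sup_top_eq]
    trivial
  | succ n ih =>
    intro s hs
    obtain ⟨t, ht⟩ := mem_sup_span_singleton_iff_exists_sub_mem.1 hs
    obtain ⟨s₁, hs₁⟩ := mem_sup_span_singleton_iff_exists_sub_mem.1 (hb s
      (mem_sup_span_singleton_iff_exists_sub_mem.2 ⟨a ^ n * t, by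
        convert ht using 1
        ring⟩))
    have h1 : b * s₁ - a ^ n * t ∈ Q := by
      apply ha
      convert sub_mem ht (Q.mul_mem_left b hs₁) using 1
      ring
    obtain ⟨t', ht'⟩ := mem_sup_span_singleton_iff_exists_sub_mem.1 (ih s₁
      (mem_sup_span_singleton_iff_exists_sub_mem.2 ⟨t, h1⟩))
    refine mem_sup_span_singleton_iff_exists_sub_mem.2 ⟨t', ?_⟩
    convert add_mem hs₁ (Q.mul_mem_left a ht') using 1
    ring

lemma IsRegularMod.sup_pow {Q : Ideal B} {a : B} {l : List B} (ha : ∀ s, a * s ∈ Q → s ∈ Q)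
    (h : IsRegularMod (Q ⊔ span {a}) l) (n : ℕ) : IsRegularMod (Q ⊔ span {a ^ n}) l := by
  induction l generalizing Q with
  | nil => trivial
  | cons b l ih =>
    refine ⟨regularMod_sup_pow ha h.1 n, ?_⟩
    have h2 := h.2
    rw [sup_right_comm] at h2 ⊢
    exact ih (regularMod_sup_swap ha h.1) h2

lemma IsRegularMod.regularMod_sup_ofList {Q : Ideal B} {a : B} {l : List B}
    (ha : ∀ s, a * s ∈ Q → s ∈ Q) (h : IsRegularMod (Q ⊔ span {a}) l) :
    ∀ s, a * s ∈ Q ⊔ ofList l → s ∈ Q ⊔ ofList l := by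
  induction l generalizing Q with
  | nil => simpa using ha
  | cons b l ih =>
    have h2 := h.2
    rw [sup_right_comm] at h2
    simpa [sup_assoc] using ih (regularMod_sup_swap ha h.1) h2

lemma IsRegularMod.map_pow {Q : Ideal B} {l : List B} (h : IsRegularMod Q l) (n : ℕ) :
    IsRegularMod Q (l.map (· ^ n)) := by
  induction l generalizing Q with
  | nil => trivial
  | cons a l ih => exact ⟨regularMod_pow h.1 n, (ih h.2).sup_pow h.1 n⟩

lemma IsMonolith.pow_mul {Q : Ideal B} {a b : B} (ha : ∀ s, a * s ∈ Q → s ∈ Q)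
    (hb : IsMonolith (Q ⊔ span {a}) b) (n : ℕ) :
    IsMonolith (Q ⊔ span {a ^ (n + 1)}) (a ^ n * b) := by
  constructor
  · intro h
    obtain ⟨s, hs⟩ := mem_sup_span_singleton_iff_exists_sub_mem.1 h
    refine hb.1 (mem_sup_span_singleton_iff_exists_sub_mem.2 ⟨s, regularMod_pow ha n _ ?_⟩)
    convert hs using 1
    ring
  · induction n with
    | zero => simpa using hb.2
    | succ n ih =>
      intro w hw
      by_cases hwa : w ∈ Q ⊔ span {a}
      · obtain ⟨v, hv⟩ := mem_sup_span_singleton_iff_exists_sub_mem.1 hwa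
        have hvn : v ∉ Q ⊔ span {a ^ (n + 1)} := by
          intro hvn
          obtain ⟨s, hs⟩ := mem_sup_span_singleton_iff_exists_sub_mem.1 hvn
          refine hw (mem_sup_span_singleton_iff_exists_sub_mem.2 ⟨s, ?_⟩)
          convert add_mem hv (Q.mul_mem_left a hs) using 1
          ring
        obtain ⟨r, hr⟩ := mem_sup_span_singleton_iff_exists_sub_mem.1 (ih v hvn)
        obtain ⟨s, hs⟩ := mem_sup_span_singleton_iff_exists_sub_mem.1 hr
        refine mem_sup_span_singleton_iff_exists_sub_mem.2
          ⟨r, mem_sup_span_singleton_iff_exists_sub_mem.2 ⟨s, ?_⟩⟩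
        convert sub_mem (Q.mul_mem_left a hs) (Q.mul_mem_left r hv) using 1
        ring
      · obtain ⟨r, hr⟩ := mem_sup_span_singleton_iff_exists_sub_mem.1 (hb.2 w hwa)
        obtain ⟨s, hs⟩ := mem_sup_span_singleton_iff_exists_sub_mem.1 hr
        refine mem_sup_span_singleton_iff_exists_sub_mem.2
          ⟨a ^ (n + 1) * r, mem_sup_span_singleton_iff_exists_sub_mem.2 ⟨s, ?_⟩⟩
        convert Q.mul_mem_left (a ^ (n + 1)) hs using 1
        ring

lemma IsRegularMod.exists_isMonolith_map_pow {Q : Ideal B} {l : List B} (h : IsRegularMod Q l)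
    {b : B} (hb : IsMonolith (Q ⊔ ofList l) b) (n : ℕ) :
    ∃ b', IsMonolith (Q ⊔ ofList (l.map (· ^ (n + 1)))) b' := by
  induction l generalizing Q with
  | nil => exact ⟨b, by simpa using hb⟩
  | cons a l ih =>
    rw [ofList_cons, ← sup_assoc] at hb
    obtain ⟨b', hb'⟩ := ih h.2 hb
    rw [sup_right_comm] at hb'
    refine ⟨a ^ n * b', ?_⟩
    rw [List.map_cons, ofList_cons, ← sup_assoc, sup_right_comm]
    exact hb'.pow_mul ((h.2.map_pow (n + 1)).regularMod_sup_ofList h.1) n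

lemma isRegularMod_of_forall {Q : Ideal B} {l : List B}
    (h : ∀ i (hi : i < l.length) s, l[i] * s ∈ Q ⊔ ofList (l.take i) →
      s ∈ Q ⊔ ofList (l.take i)) : IsRegularMod Q l := by
  induction l generalizing Q with
  | nil => trivial
  | cons a l ih =>
    refine ⟨fun s hs => by simpa using h 0 (by simp) s (by simpa using hs), ih fun i hi s hs => ?_⟩
    have := h (i + 1) (by simpa using hi) s
    rw [List.take_succ_cons, ofList_cons, ← sup_assoc] at this
    exact this hs

lemma isRegularMod_bot_of_isWeaklyRegular {l : List B}
    (h : RingTheory.Sequence.IsWeaklyRegular B l) : IsRegularMod ⊥ l := by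
  refine isRegularMod_of_forall fun i hi s hs => ?_
  rw [bot_sup_eq] at hs ⊢
  have htop : (ofList (l.take i) • ⊤ : Submodule B B) = ofList (l.take i) := by simp
  have hreg := h.regular_mod_prev i hi
  rw [htop] at hreg
  rw [← Quotient.eq_zero_iff_mem] at hs ⊢
  refine hreg (?_ : l[i] • Quotient.mk (ofList (l.take i)) s = l[i] • 0)
  rw [smul_zero, ← hs, map_mul]
  rfl

lemma IsRegularMod.comap {f : B →+* C} (hf : Function.Surjective f) {Q : Ideal C} {l : List B}
    (h : IsRegularMod Q (l.map f)) : IsRegularMod (Q.comap f) l := by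
  induction l generalizing Q with
  | nil => trivial
  | cons a l ih =>
    refine ⟨fun s hs => h.1 (f s) (by simpa using hs), ?_⟩
    have hsup : (Q ⊔ span {f a}).comap f = Q.comap f ⊔ span {a} := by
      ext x
      rw [mem_comap, mem_sup_span_singleton_iff_exists_sub_mem,
        mem_sup_span_singleton_iff_exists_sub_mem, hf.exists]
      simp
    rw [← hsup]
    exact ih h.2

lemma IsMonolith.comap {f : B →+* C} (hf : Function.Surjective f) {Q : Ideal C} {b : B}
    (h : IsMonolith Q (f b)) : IsMonolith (Q.comap f) b := by
  refine ⟨h.1, fun w hw => ?_⟩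
  obtain ⟨s, hs⟩ := mem_sup_span_singleton_iff_exists_sub_mem.1 (h.2 (f w) hw)
  obtain ⟨s, rfl⟩ := hf s
  exact mem_sup_span_singleton_iff_exists_sub_mem.2 ⟨s, by simpa using hs⟩

end RegularMod

section ColonCompatible

variable {R S : Type*} [CommRing R] [CommRing S] [Algebra R S]

lemma algebraMap_mul_mem_map_sup {a b : Ideal R} {Z : Ideal S} {u : R}
    (h : ∀ r ∈ b, r * u ∈ a) {t : S} (ht : t ∈ b.map (algebraMap R S) ⊔ Z) :
    algebraMap R S u * t ∈ a.map (algebraMap R S) ⊔ Z := by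
  obtain ⟨y, hy, z, hz, rfl⟩ := Submodule.mem_sup.1 ht
  rw [mul_add]
  refine add_mem (mem_sup_left ?_) (mem_sup_right (Z.mul_mem_left _ hz))
  have : b.map (algebraMap R S) ≤
      Submodule.comap (LinearMap.mulLeft S (algebraMap R S u)) (a.map (algebraMap R S)) := by
    refine map_le_iff_le_comap.2 fun r hr => ?_
    change algebraMap R S u * algebraMap R S r ∈ a.map (algebraMap R S)
    rw [← map_mul, mul_comm]
    exact mem_map_of_mem _ (h r hr)
  exact this hy

lemma map_sup_span_singleton_sup (a : Ideal R) (u : R) (Z : Ideal S) :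
    (a ⊔ span {u}).map (algebraMap R S) ⊔ Z =
      a.map (algebraMap R S) ⊔ Z ⊔ span {algebraMap R S u} := by
  rw [map_sup, map_span, Set.image_singleton, sup_right_comm]

/-- Colons by elements of `R` of ideals primary to the maximal ideal of `R` commute with extension
to `S ⧸ Z`. -/
def IsColonCompatible (R : Type*) {S : Type*} [CommRing R] [IsLocalRing R] [CommRing S]
    [Algebra R S] (Z : Ideal S) : Prop :=
  ∀ (a b : Ideal R) (u : R) (t : S), (∃ n, maximalIdeal R ^ n ≤ a) → (∀ r, r * u ∈ a → r ∈ b) →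
    algebraMap R S u * t ∈ a.map (algebraMap R S) ⊔ Z → t ∈ b.map (algebraMap R S) ⊔ Z

variable [IsLocalRing R]

lemma isColonCompatible_bot [Module.Flat R S] : IsColonCompatible R (⊥ : Ideal S) := by
  intro a b u t _ hb ht
  rw [sup_bot_eq] at ht ⊢
  obtain ⟨n, f, g, hg⟩ := Submodule.mem_span_set'.1 ht
  choose α hα hαg using fun i => (g i).2
  have hrel : ∑ i : Option (Fin n), (i.elim u fun j => -α j) • (i.elim t f) = 0 := by
    rw [Fintype.sum_option]
    simp only [Option.elim, Algebra.smul_def, map_neg, neg_mul, Finset.sum_neg_distrib]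
    rw [← hg, add_neg_eq_zero]
    refine Finset.sum_congr rfl fun i _ => ?_
    rw [← hαg, smul_eq_mul, mul_comm]
  obtain ⟨k, c, y, hy, hc⟩ := Module.Flat.isTrivialRelation_of_sum_smul_eq_zero
    (f := fun i : Option (Fin n) => i.elim u fun j => -α j) (x := fun i => i.elim t f) hrel
  have hyt : t = ∑ j, c none j • y j := hy none
  rw [hyt]
  refine _root_.sum_mem fun j _ => ?_
  rw [Algebra.smul_def]
  refine mul_mem_right _ _ (mem_map_of_mem _ (hb _ ?_))
  have hcj := hc j
  rw [Fintype.sum_option] at hcj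
  simp only [Option.elim, neg_mul, Finset.sum_neg_distrib, add_neg_eq_zero] at hcj
  rw [mul_comm, hcj]
  exact _root_.sum_mem fun i _ => a.mul_mem_right _ (hα i)

lemma exists_forall_mem_maximalIdeal_mul_mem {a : Ideal R} {n : ℕ} (hn : maximalIdeal R ^ n ≤ a)
    (ha : a ≠ ⊤) : ∃ u ∉ a, ∀ r ∈ maximalIdeal R, r * u ∈ a := by
  obtain ⟨u, hu, hsoc⟩ := exists_mul_notMem_of_pow_le hn ((ne_top_iff_one a).1 ha)
  rw [mul_one] at hu hsoc
  exact ⟨u, hu, hsoc⟩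

lemma mem_maximalIdeal_of_mul_mem {a : Ideal R} {u r : R} (hu : u ∉ a) (hr : r * u ∈ a) :
    r ∈ maximalIdeal R :=
  fun h => hu ((a.unit_mul_mem_iff_mem h).1 hr)

lemma IsColonCompatible.regularMod [IsNoetherianRing R] {Z : Ideal S} (hZ : IsColonCompatible R Z)
    {z : S} (hz : ∀ s, z * s ∈ (maximalIdeal R).map (algebraMap R S) ⊔ Z →
      s ∈ (maximalIdeal R).map (algebraMap R S) ⊔ Z) {a : Ideal R} {n : ℕ}
    (hn : maximalIdeal R ^ n ≤ a) (s : S) (hs : z * s ∈ a.map (algebraMap R S) ⊔ Z) :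
    s ∈ a.map (algebraMap R S) ⊔ Z := by
  induction a using WellFoundedGT.induction generalizing s with
  | ind a ih =>
    by_cases ha : a = ⊤
    · rw [ha, map_top, top_sup_eq]
      trivial
    · obtain ⟨u, hu, hsoc⟩ := exists_forall_mem_maximalIdeal_mul_mem hn ha
      have hlt : a < a ⊔ span {u} := by
        refine lt_of_le_of_ne le_sup_left fun he => hu ?_
        rw [he]
        exact mem_sup_right (mem_span_singleton_self u)
      have h1 := ih _ hlt (hn.trans le_sup_left) s
        ((sup_le_sup_right (map_mono le_sup_left) Z) hs)
      rw [map_sup_span_singleton_sup] at h1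
      obtain ⟨t, ht⟩ := mem_sup_span_singleton_iff_exists_sub_mem.1 h1
      have h2 : algebraMap R S u * (z * t) ∈ a.map (algebraMap R S) ⊔ Z := by
        convert sub_mem hs (mul_mem_left _ z ht) using 1
        ring
      have h3 := hz t (hZ a _ u _ ⟨n, hn⟩ (fun r => mem_maximalIdeal_of_mul_mem hu) h2)
      convert add_mem ht (algebraMap_mul_mem_map_sup hsoc h3) using 1
      ring

lemma IsColonCompatible.sup_span_singleton [IsNoetherianRing R] {Z : Ideal S}
    (hZ : IsColonCompatible R Z) {z : S}
    (hz : ∀ s, z * s ∈ (maximalIdeal R).map (algebraMap R S) ⊔ Z →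
      s ∈ (maximalIdeal R).map (algebraMap R S) ⊔ Z) : IsColonCompatible R (Z ⊔ span {z}) := by
  rintro a b u t ⟨n, hn⟩ hb ht
  rw [← sup_assoc] at ht ⊢
  obtain ⟨s, hs⟩ := mem_sup_span_singleton_iff_exists_sub_mem.1 ht
  have h1 : z * s ∈ (a ⊔ span {u}).map (algebraMap R S) ⊔ Z := by
    rw [map_sup_span_singleton_sup]
    refine mem_sup_span_singleton_iff_exists_sub_mem.2 ⟨t, ?_⟩
    convert neg_mem hs using 1
    ring
  have h2 := hZ.regularMod hz (hn.trans le_sup_left) s h1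
  rw [map_sup_span_singleton_sup] at h2
  obtain ⟨s', hs'⟩ := mem_sup_span_singleton_iff_exists_sub_mem.1 h2
  refine mem_sup_span_singleton_iff_exists_sub_mem.2 ⟨s', hZ a b u _ ⟨n, hn⟩ hb ?_⟩
  convert add_mem hs (mul_mem_left _ z hs') using 1
  ring

lemma IsColonCompatible.sup_ofList [IsNoetherianRing R] {Z : Ideal S}
    (hZ : IsColonCompatible R Z) {l : List S}
    (hl : IsRegularMod ((maximalIdeal R).map (algebraMap R S) ⊔ Z) l) :
    IsColonCompatible R (Z ⊔ ofList l) := by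
  induction l generalizing Z with
  | nil => simpa using hZ
  | cons z l ih =>
    rw [ofList_cons, ← sup_assoc]
    refine ih (hZ.sup_span_singleton hl.1) ?_
    rw [← sup_assoc]
    exact hl.2

lemma isColonCompatible_ofList [IsNoetherianRing R] [Module.Flat R S] {l : List S}
    (hl : IsRegularMod ((maximalIdeal R).map (algebraMap R S)) l) :
    IsColonCompatible R (ofList l) := by
  have := (isColonCompatible_bot (R := R) (S := S)).sup_ofList (l := l) (by rwa [sup_bot_eq])
  rwa [bot_sup_eq] at this

lemma IsColonCompatible.isMonolith_map_sup [IsNoetherianRing R] {Z : Ideal S}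
    (hZ : IsColonCompatible R Z) {I : Ideal R} {u : R} (hu : IsMonolith I u) {b : S}
    (hb : IsMonolith ((maximalIdeal R).map (algebraMap R S) ⊔ Z) b) :
    IsMonolith (I.map (algebraMap R S) ⊔ Z) (algebraMap R S u * b) := by
  obtain ⟨n, hn⟩ := hu.pow_le
  refine ⟨fun h => hb.1 (hZ I _ u b ⟨n, hn⟩ (fun r => mem_maximalIdeal_of_mul_mem hu.1) h),
    fun w hw => ?_⟩
  obtain ⟨a, ⟨hIa, hwa⟩, hmax⟩ :=
    set_has_maximal_iff_noetherian.2 (inferInstanceAs (IsNoetherian R R))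
      {a : Ideal R | I ≤ a ∧ w ∉ a.map (algebraMap R S) ⊔ Z} ⟨I, le_rfl, hw⟩
  have ha : a ≠ ⊤ := by
    rintro rfl
    rw [map_top, top_sup_eq] at hwa
    exact hwa trivial
  obtain ⟨v, hv, hsoc⟩ := exists_forall_mem_maximalIdeal_mul_mem (hn.trans hIa) ha
  have hwv : w ∈ Ideal.map (algebraMap R S) (a ⊔ span {v}) ⊔ Z := by
    by_contra hc
    refine hmax (a ⊔ span {v}) ⟨hIa.trans le_sup_left, hc⟩ ?_
    refine lt_of_le_of_ne le_sup_left fun he => hv ?_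
    rw [he]
    exact mem_sup_right (mem_span_singleton_self v)
  rw [map_sup_span_singleton_sup] at hwv
  obtain ⟨t, ht⟩ := mem_sup_span_singleton_iff_exists_sub_mem.1 hwv
  have htm : t ∉ (maximalIdeal R).map (algebraMap R S) ⊔ Z := by
    intro htm
    refine hwa ?_
    convert add_mem ht (algebraMap_mul_mem_map_sup hsoc htm) using 1
    ring
  obtain ⟨r, hr, hrv⟩ := hu.exists_mul_mem hIa hv
  have h1 := algebraMap_mul_mem_map_sup (u := r) (fun s hs => by rw [mul_comm]; exact hr s hs) ht
  obtain ⟨s, hs⟩ := mem_sup_span_singleton_iff_exists_sub_mem.1 (hu.2 _ hrv)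
  obtain ⟨k, hk⟩ := mem_sup_span_singleton_iff_exists_sub_mem.1 (hb.2 t htm)
  have h2 := algebraMap_mul_mem_map_sup (fun x hx => hu.mul_mem hx) hk
  have h3 : algebraMap R S (u - r * v * s) ∈ I.map (algebraMap R S) ⊔ Z :=
    mem_sup_left (mem_map_of_mem _ hs)
  refine mem_sup_span_singleton_iff_exists_sub_mem.2
    ⟨algebraMap R S r * algebraMap R S s * k, ?_⟩
  convert sub_mem (add_mem h2 (mul_mem_right (t * k) _ h3))
    (mul_mem_right (algebraMap R S s * k) _ h1) using 1
  simp only [map_sub, map_mul]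
  ring

end ColonCompatible

section Frobenius

variable {B C : Type*} [CommRing B] [CommRing C]

lemma pow_mem_frobPow {I : Ideal B} {x : B} (hx : x ∈ I) (q : ℕ) : x ^ q ∈ I.frobPow q :=
  subset_span ⟨x, hx, rfl⟩

lemma frobPow_mono {I J : Ideal B} (h : I ≤ J) (q : ℕ) : I.frobPow q ≤ J.frobPow q :=
  span_mono (Set.image_mono h)

lemma exists_pow_le_frobPow [IsNoetherianRing B] {I J : Ideal B} {n : ℕ} (h : J ^ n ≤ I) (q : ℕ) :
    ∃ m, J ^ m ≤ I.frobPow q := by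
  refine exists_pow_le_of_le_radical_of_fg (fun x hx => ?_) (IsNoetherian.noetherian J)
  exact ⟨n * q, by
    rw [_root_.pow_mul]
    exact pow_mem_frobPow (h (pow_mem_pow hx n)) q⟩

variable (p : ℕ) [Fact p.Prime] [CharP B p] [CharP C p]

lemma frobPow_eq_map_iterateFrobenius (I : Ideal B) (e : ℕ) :
    I.frobPow (p ^ e) = I.map (iterateFrobenius B p e) :=
  rfl

lemma frobPow_sup (I J : Ideal B) (e : ℕ) :
    (I ⊔ J).frobPow (p ^ e) = I.frobPow (p ^ e) ⊔ J.frobPow (p ^ e) := by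
  simp only [frobPow_eq_map_iterateFrobenius p, map_sup]

lemma frobPow_map (f : B →+* C) (I : Ideal B) (e : ℕ) :
    (I.map f).frobPow (p ^ e) = (I.frobPow (p ^ e)).map f := by
  simp only [frobPow_eq_map_iterateFrobenius p, map_map]
  congr 1
  ext x
  simp [iterateFrobenius_def]

lemma frobPow_ofList (l : List B) (e : ℕ) :
    (ofList l).frobPow (p ^ e) = ofList (l.map (· ^ p ^ e)) := by
  rw [frobPow_eq_map_iterateFrobenius p, map_ofList]
  rfl

end Frobenius

section TightClosure

variable {B : Type*} [CommRing B] {p : ℕ}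

lemma _root_.MemTightClosure.mono {I J : Ideal B} {x : B} (hx : MemTightClosure p I x)
    (h : I ≤ J) : MemTightClosure p J x := by
  obtain ⟨c, hc, N, hN⟩ := hx
  exact ⟨c, hc, N, fun e he => frobPow_mono h _ (hN e he)⟩

lemma _root_.MemTightClosure.mul_of_forall [Fact p.Prime] [CharP B p] {I J : Ideal B} {r x : B}
    (hx : MemTightClosure p J x) (h : ∀ j ∈ J, r * j ∈ I) : MemTightClosure p I (r * x) := by
  obtain ⟨c, hc, N, hN⟩ := hx
  refine ⟨c, hc, N, fun e he => ?_⟩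
  have hle : span {r} * J ≤ I := span_singleton_mul_le_iff.2 h
  refine frobPow_mono hle _ ?_
  rw [frobPow_eq_map_iterateFrobenius p, Ideal.map_mul, map_span, Set.image_singleton,
    ← frobPow_eq_map_iterateFrobenius p, mul_pow, mul_left_comm]
  exact mul_mem_mul (mem_span_singleton_self _) (hN e he)

lemma _root_.MemTightClosure.of_mem_sup_span_singleton [Fact p.Prime] [CharP B p] {I : Ideal B}
    {x y : B} (hx : MemTightClosure p I x) (hy : y ∈ I ⊔ span {x}) : MemTightClosure p I y := by
  obtain ⟨c, hc, N, hN⟩ := hx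
  obtain ⟨s, hs⟩ := mem_sup_span_singleton_iff_exists_sub_mem.1 hy
  refine ⟨c, hc, N, fun e he => ?_⟩
  have h1 := pow_mem_frobPow hs (p ^ e)
  rw [sub_pow_expChar_pow, mul_pow] at h1
  have : c * y ^ p ^ e = c * (y ^ p ^ e - x ^ p ^ e * s ^ p ^ e) + c * x ^ p ^ e * s ^ p ^ e := by
    ring
  rw [this]
  exact add_mem (mul_mem_left _ _ h1) (mul_mem_right _ _ (hN e he))

end TightClosure

end Ideal

section ApproximatelyGorenstein

variable {B : Type*} [CommRing B]

lemma mem_circComplement_of_regular {x : B} (hx : ∀ s, x * s = 0 → s = 0) :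
    x ∈ circComplement B := by
  intro P hP hxP
  refine notMem_nonZeroDivisors_of_mem_mem_minimalPrimes hxP hP ?_
  exact mem_nonZeroDivisors_iff_right.2 fun s hs => hx s (by rw [mul_comm, hs])

variable {p : ℕ}

/-- In a weakly F-regular local ring whose maximal ideal is the radical of an ideal generated by
a regular element, the maximal ideal is principal. -/
lemma IsWeaklyFRegular.exists_maximalIdeal_eq_span_singleton [IsNoetherianRing B] [IsLocalRing B]
    (h : IsWeaklyFRegular B p) {x : B} (hxm : x ∈ maximalIdeal B) (hx : ∀ s, x * s = 0 → s = 0)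
    (hrad : maximalIdeal B ≤ (Ideal.span {x}).radical) :
    ∃ r, maximalIdeal B = Ideal.span {r} ∧ ∀ s, r * s = 0 → s = 0 := by
  obtain ⟨n, hn⟩ := Ideal.exists_pow_le_of_le_radical_of_fg hrad (IsNoetherian.noetherian _)
  have hne : Ideal.span {x} ≠ ⊤ := fun he =>
    (mem_maximalIdeal x).1 hxm (Ideal.span_singleton_eq_top.1 he)
  obtain ⟨y, hy, hsoc⟩ := Ideal.exists_forall_mem_maximalIdeal_mul_mem hn hne
  have hsoc' : ∀ s ∈ maximalIdeal B, ∃ t, s * y = x * t := by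
    intro s hs
    obtain ⟨t, ht⟩ := Ideal.mem_span_singleton'.1 (hsoc s hs)
    exact ⟨t, by rw [← ht, mul_comm]⟩
  by_cases hex : ∃ r ∈ maximalIdeal B, ∃ t, IsUnit t ∧ r * y = x * t
  · obtain ⟨r, hr, t, ht, hrt⟩ := hex
    obtain ⟨t', ht'⟩ := ht.exists_right_inv
    have hyreg : ∀ s, y * s = 0 → s = 0 := by
      intro s hs
      refine hx s ?_
      linear_combination t' * r * hs - s * t' * hrt - x * s * ht'
    refine ⟨r, le_antisymm (fun s hs => ?_) ((Ideal.span_singleton_le_iff_mem _).2 hr),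
      fun s hs => hx s ?_⟩
    · obtain ⟨k, hk⟩ := hsoc' s hs
      refine Ideal.mem_span_singleton'.2 ⟨k * t', ?_⟩
      rw [← sub_eq_zero]
      apply hyreg
      linear_combination k * t' * hrt - hk + x * k * ht'
    · linear_combination t' * y * hs - s * t' * hrt - x * s * ht'
  · push Not at hex
    exfalso
    refine hy (h _ y ⟨x, mem_circComplement_of_regular hx, 0, fun e _ => ?_⟩)
    have key : ∀ q, ∃ t ∈ maximalIdeal B, x * y ^ q = x ^ q * t := by
      intro q
      induction q with
      | zero => exact ⟨x, hxm, by ring⟩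
      | succ q ih =>
        obtain ⟨t, ht, hxt⟩ := ih
        obtain ⟨k, hk⟩ := hsoc' t ht
        refine ⟨k, fun hku => hex t ht k hku hk, ?_⟩
        linear_combination y * hxt + x ^ q * hk
    obtain ⟨t, -, ht⟩ := key (p ^ e)
    rw [ht]
    exact Ideal.mul_mem_right _ _
      (Ideal.pow_mem_frobPow (Ideal.mem_span_singleton_self x) _)

/-- Cohen-Macaulay weakly F-regular local rings are approximately Gorenstein. -/
lemma IsWeaklyFRegular.exists_isMonolith_le_pow [Fact p.Prime] [IsNoetherianRing B] [IsLocalRing B]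
    (h : IsWeaklyFRegular B p) (hCM : IsCohenMacaulayLocalRing B) (N : ℕ) :
    ∃ I u, Ideal.IsMonolith I u ∧ I ≤ maximalIdeal B ^ N := by
  obtain ⟨n, x, ⟨-, hxm, hrad⟩, hreg⟩ := hCM
  have hreg' := Ideal.isRegularMod_bot_of_isWeaklyRegular hreg.toIsWeaklyRegular
  match n, x with
  | 0, x =>
    rw [Set.range_eq_empty, Ideal.span_empty] at hrad
    have hm : maximalIdeal B = ⊥ := by
      refine eq_bot_iff.2 fun y hy => h ⊥ y ?_
      obtain ⟨k, hk⟩ := hrad hy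
      refine ⟨1, fun P hP h1 => hP.1.1.ne_top ((Ideal.eq_top_iff_one P).2 h1), k, fun e he => ?_⟩
      have hke : k ≤ p ^ e := he.trans (Nat.lt_pow_self (Fact.out : p.Prime).one_lt).le
      rw [one_mul, pow_eq_zero_of_le hke hk]
      exact zero_mem _
    exact ⟨maximalIdeal B, 1, Ideal.isMonolith_maximalIdeal, hm ▸ bot_le⟩
  | 1, x =>
    have hrange : Set.range x = {x 0} := by
      rw [Set.range_unique]
      rfl
    rw [hrange] at hrad
    obtain ⟨r, hr, hr0⟩ := h.exists_maximalIdeal_eq_span_singleton (hxm 0)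
      (by simpa [List.ofFn_succ, Ideal.IsRegularMod] using hreg') hrad
    have hmon : Ideal.IsMonolith (⊥ ⊔ Ideal.span {r}) (1 : B) := by
      rw [bot_sup_eq, ← hr]
      exact Ideal.isMonolith_maximalIdeal
    refine ⟨_, _, hmon.pow_mul (by simpa using hr0) N, ?_⟩
    rw [bot_sup_eq, ← Ideal.span_singleton_pow, ← hr]
    exact Ideal.pow_le_pow_right N.le_succ
  | n + 2, x =>
    rw [List.ofFn_succ, List.ofFn_succ] at hreg'
    obtain ⟨h0, h1, -⟩ := hreg'
    exact Ideal.exists_isMonolith_le_pow (hxm 0) (hxm (Fin.succ 0)) (by simpa using h0)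
      (by simpa using h1) N

end ApproximatelyGorenstein

namespace Ideal

section ClosedFiber

variable {B : Type*} [CommRing B]

lemma span_range_eq_ofList_ofFn {n : ℕ} (x : Fin n → B) :
    span (Set.range x) = ofList (List.ofFn x) := by
  rw [ofList]
  congr 1
  ext y
  simp [List.mem_ofFn]

lemma ofList_map_pow_le_frobPow (l : List B) (q : ℕ) :
    ofList (l.map (· ^ q)) ≤ (ofList l).frobPow q := by
  refine span_le.2 fun y hy => ?_
  obtain ⟨x, hx, rfl⟩ := List.mem_map.1 hy
  exact pow_mem_frobPow (subset_span (s := {x | x ∈ l}) hx) q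

lemma ofList_map_pow_le_pow {J : Ideal B} {l : List B} (h : ∀ x ∈ l, x ∈ J) (n : ℕ) :
    ofList (l.map (· ^ n)) ≤ J ^ n := by
  refine span_le.2 fun y hy => ?_
  obtain ⟨x, hx, rfl⟩ := List.mem_map.1 hy
  exact pow_mem_pow (h x hx) n

lemma comap_ofList_map {C : Type*} [CommRing C] {f : B →+* C} (hf : Function.Surjective f)
    (l : List B) : (ofList (l.map f)).comap f = RingHom.ker f ⊔ ofList l := by
  rw [← map_ofList, comap_map_of_surjective f hf, sup_comm]
  rfl

variable [IsLocalRing B]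

lemma _root_.IsSystemOfParameters.pow {n : ℕ} {x : Fin n → B} (hx : IsSystemOfParameters B x)
    {k : ℕ} (hk : k ≠ 0) : IsSystemOfParameters B fun i => x i ^ k := by
  refine ⟨hx.1, fun i => pow_mem_of_mem _ (hx.2.1 i) k (Nat.pos_of_ne_zero hk),
    hx.2.2.trans (radical_le_radical_iff.2 (span_le.2 ?_))⟩
  rintro _ ⟨i, rfl⟩
  exact ⟨k, subset_span ⟨i, rfl⟩⟩

lemma _root_.IsSystemOfParameters.isParameterIdeal {n : ℕ} {x : Fin n → B}
    (hx : IsSystemOfParameters B x) : (ofList (List.ofFn x)).IsParameterIdeal :=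
  ⟨n, n, le_rfl, x, hx, (span_range_eq_ofList_ofFn x).symm⟩

/-- A Gorenstein quotient `B ⧸ Q` has a system of parameters that lifts to a sequence of `B`
which is regular modulo `Q` and generates an irreducible ideal modulo `Q`. -/
lemma _root_.IsGorensteinLocalRing.exists_isRegularMod [IsNoetherianRing B] {Q : Ideal B}
    [IsLocalRing (B ⧸ Q)] (h : IsGorensteinLocalRing (B ⧸ Q)) :
    ∃ l : List B, (∀ z ∈ l, z ∈ maximalIdeal B) ∧ IsRegularMod Q l ∧
      (∃ b, IsMonolith (Q ⊔ ofList l) b) ∧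
      ∀ k ≠ 0, (ofList ((l.map (· ^ k)).map (Quotient.mk Q))).IsParameterIdeal := by
  obtain ⟨n, x, hx, hreg, hirr⟩ := h
  have hsurj : Function.Surjective (Quotient.mk Q) := Quotient.mk_surjective
  choose z hz using fun i => hsurj (x i)
  have hmap : (List.ofFn z).map (Quotient.mk Q) = List.ofFn x := by
    rw [List.map_ofFn]
    exact congrArg List.ofFn (funext hz)
  refine ⟨List.ofFn z, fun y hy => ?_, ?_, ?_, fun k hk => ?_⟩
  · obtain ⟨i, rfl⟩ := (List.mem_ofFn' z y).1 hy
    refine (mem_maximalIdeal _).2 fun hu => (mem_maximalIdeal _).1 (hx.2.1 i) ?_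
    rw [← hz]
    exact hu.map _
  · have := isRegularMod_bot_of_isWeaklyRegular hreg.toIsWeaklyRegular
    rw [← hmap] at this
    have := this.comap hsurj
    rwa [← RingHom.ker_eq_comap_bot, mk_ker] at this
  · obtain ⟨m, hm⟩ := exists_pow_le_of_le_radical_of_fg hx.2.2 (IsNoetherian.noetherian _)
    obtain ⟨b', hb'⟩ := hirr.exists_isMonolith hm
    obtain ⟨b, rfl⟩ := hsurj b'
    refine ⟨b, ?_⟩
    have := hb'.comap hsurj
    rwa [span_range_eq_ofList_ofFn, ← hmap, comap_ofList_map hsurj, mk_ker] at this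
  · have : ((List.ofFn z).map (· ^ k)).map (Quotient.mk Q) = List.ofFn fun i => x i ^ k := by
      rw [List.map_ofFn, List.map_ofFn]
      refine congrArg List.ofFn (funext fun i => ?_)
      simp [hz]
    rw [this]
    exact (hx.pow hk).isParameterIdeal

end ClosedFiber

end Ideal

/-- **Theorem 3.4(1)** (Aberbach). Let `φ : (R,m) → (S,n)` be a flat local homomorphism of
Noetherian local rings of prime characteristic `p` with Gorenstein closed fiber `S/mS`.
If `R` is weakly F-regular and Cohen-Macaulay, `c ∈ R°` has image in `S°` and is a test
element for both `R` and `S`, and `S/mS` is F-injective, then `S` is weakly F-regular. -/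
theorem weaklyFRegular_of_flat_of_gorenstein_fiber_of_common_test_element
    (p : ℕ) [Fact p.Prime]
    (R S : Type*) [CommRing R] [CommRing S]
    [IsNoetherianRing R] [IsNoetherianRing S]
    [IsLocalRing R] [IsLocalRing S] [CharP R p] [CharP S p]
    [Algebra R S] [Module.Flat R S] [IsLocalHom (algebraMap R S)]
    [IsLocalRing (S ⧸ Ideal.map (algebraMap R S) (IsLocalRing.maximalIdeal R))]
    (hGor : IsGorensteinLocalRing (S ⧸ Ideal.map (algebraMap R S) (IsLocalRing.maximalIdeal R)))
    (hWFR : IsWeaklyFRegular R p) (hCM : IsCohenMacaulayLocalRing R)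
    (c : R) (hcR : IsTestElement p c) (hcS : IsTestElement p (algebraMap R S c))
    (hFinj : IsFInjective (S ⧸ Ideal.map (algebraMap R S) (IsLocalRing.maximalIdeal R)) p) :
    IsWeaklyFRegular S p := by
  intro J₀ x hx₀
  by_contra hxJ₀
  obtain ⟨J, hJ₀, hJ⟩ := Ideal.exists_le_isMonolith hxJ₀
  have hx := hx₀.mono hJ₀
  obtain ⟨N, hN⟩ := hJ.pow_le
  obtain ⟨l₀, hl₀, hreg₀, ⟨b₀, hb₀⟩, hpar⟩ := hGor.exists_isRegularMod
  obtain ⟨b, hb⟩ := hreg₀.exists_isMonolith_map_pow hb₀ N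
  obtain ⟨I, u, hu, hI⟩ := hWFR.exists_isMonolith_le_pow hCM N
  have hreg := hreg₀.map_pow (N + 1)
  have hpar := hpar (N + 1) N.succ_ne_zero
  have hlJ : Ideal.ofList (l₀.map (· ^ (N + 1))) ≤ J :=
    ((Ideal.ofList_map_pow_le_pow hl₀ _).trans (Ideal.pow_le_pow_right N.le_succ)).trans hN
  generalize l₀.map (· ^ (N + 1)) = l at *
  have hA := (Ideal.isColonCompatible_ofList hreg).isMonolith_map_sup hu hb
  have hAJ : I.map (algebraMap R S) ⊔ Ideal.ofList l ≤ J := by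
    refine sup_le ((Ideal.map_mono hI).trans ?_) hlJ
    rw [Ideal.map_pow]
    exact (Ideal.pow_right_mono (IsLocalRing.map_maximalIdeal_le (algebraMap R S)) N).trans hN
  obtain ⟨s, hs, hsx⟩ := hA.exists_mul_mem hAJ hJ.1
  have hub := (hx.mul_of_forall hs).of_mem_sup_span_singleton (hA.2 _ hsx)
  obtain ⟨e, he⟩ : ∃ e, c * u ^ p ^ e ∉ I.frobPow (p ^ e) := by
    by_contra! hc
    exact hu.1 (hWFR I u ⟨c, hcR.1, 0, fun e _ => hc e⟩)
  have hcub := hcS.2 _ _ hub e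
  rw [Ideal.frobPow_sup p, Ideal.frobPow_map p, Ideal.frobPow_ofList p, mul_pow, ← mul_assoc,
    ← map_pow, ← map_mul] at hcub
  obtain ⟨k, hk⟩ := hu.pow_le
  have hbq := Ideal.isColonCompatible_ofList (hreg.map_pow (p ^ e)) _ _ _ _
    (Ideal.exists_pow_le_frobPow hk (p ^ e))
    (fun r => Ideal.mem_maximalIdeal_of_mul_mem he) hcub
  have hsurj := Ideal.Quotient.mk_surjective
    (I := (maximalIdeal R).map (algebraMap R S))
  refine hb.1 ?_
  rw [← Ideal.mk_ker (I := (maximalIdeal R).map (algebraMap R S)),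
    ← Ideal.comap_ofList_map hsurj, Ideal.mem_comap] at hbq ⊢
  refine hFinj _ hpar _ ⟨e, Ideal.ofList_map_pow_le_frobPow _ _ ?_⟩
  rw [map_pow] at hbq
  convert hbq using 2
  simp [List.map_map, Function.comp_def]
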